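/- For each ν ≥ 0, the function x ↦ I_ν(x) K_ν(x) + ln x is increasing on (0, ∞). -/

import Mathlib

open Real MeasureTheory Set Filter

/-- Modified Bessel function of the first kind `I_ν`. -/
noncomputable def besselI (ν x : ℝ) : ℝ :=
  ∑' n : ℕ, (x / 2) ^ (2 * (n : ℝ) + ν) / ((n.factorial : ℝ) * Real.Gamma ((n : ℝ) + ν + 1))

/-- Modified Bessel function of the second kind `K_ν`. -/
noncomputable def besselK (ν x : ℝ) : ℝ :=
  ∫ t in Ioi (0 : ℝ), Real.exp (-x * Real.cosh t) * Real.cosh (ν * t)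

/-- Bessel function of the first kind `J_ν`. -/
noncomputable def besselJ (ν x : ℝ) : ℝ :=
  ∑' n : ℕ, (-1 : ℝ) ^ n * (x / 2) ^ (2 * (n : ℝ) + ν) /
    ((n.factorial : ℝ) * Real.Gamma ((n : ℝ) + ν + 1))

/-- Modified Struve function of the first kind `L_ν`. -/
noncomputable def struveL (ν x : ℝ) : ℝ :=
  ∑' n : ℕ, (x / 2) ^ (2 * (n : ℝ) + ν + 1) /
    (Real.Gamma ((n : ℝ) + 3 / 2) * Real.Gamma ((n : ℝ) + ν + 3 / 2))

/-- Airy function `Ai`. -/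
noncomputable def airyAi (t : ℝ) : ℝ :=
  (1 / Real.pi) * ∫ s in Ioi (0 : ℝ), Real.cos (s ^ 3 / 3 + s * t)

/-- Landau constant `b_L = 2^{1/3} ⬝ sup_{t ≥ 0} Ai(t)`. -/
noncomputable def landau_bL : ℝ :=
  (2 : ℝ) ^ ((1 : ℝ) / 3) * sSup (airyAi '' Ici 0)

/-- Landau constant `c_L = sup_{t ≥ 0} t^{1/3} J₀(t)`. -/
noncomputable def landau_cL : ℝ :=
  sSup ((fun t : ℝ => t ^ ((1 : ℝ) / 3) * besselJ 0 t) '' Ici 0)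

/-- The entire part of the modified Bessel function: `I_ν(x) = (x/2)^ν * besselEntire ν (x²/4)`. -/
noncomputable def besselEntire (ν z : ℝ) : ℝ :=
  ∑' n : ℕ, z ^ n / ((n.factorial : ℝ) * Real.Gamma ((n : ℝ) + ν + 1))

lemma gamma_le_gamma_natCast_add {ν : ℝ} (hν : 0 ≤ ν) (n : ℕ) :
    Real.Gamma (ν + 1) ≤ Real.Gamma ((n : ℝ) + ν + 1) := by
  induction n with
  | zero => simp
  | succ n ih =>
    have h : Real.Gamma (((n + 1 : ℕ) : ℝ) + ν + 1)
        = ((n : ℝ) + ν + 1) * Real.Gamma ((n : ℝ) + ν + 1) := by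
      rw [← Real.Gamma_add_one (by positivity)]
      push_cast
      ring_nf
    have h0 : 0 < Real.Gamma ((n : ℝ) + ν + 1) := Real.Gamma_pos_of_pos (by positivity)
    rw [h]
    nlinarith [mul_nonneg (add_nonneg n.cast_nonneg hν : 0 ≤ (n : ℝ) + ν) h0.le]

lemma summable_besselEntire {ν : ℝ} (hν : 0 ≤ ν) (z : ℝ) :
    Summable fun n : ℕ => z ^ n / ((n.factorial : ℝ) * Real.Gamma ((n : ℝ) + ν + 1)) := by
  have hG : 0 < Real.Gamma (ν + 1) := Real.Gamma_pos_of_pos (by positivity)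
  refine Summable.of_norm_bounded ((Real.summable_pow_div_factorial |z|).mul_right
    (Real.Gamma (ν + 1))⁻¹) fun n => ?_
  have h := gamma_le_gamma_natCast_add hν n
  rw [norm_div, norm_mul, norm_pow, Real.norm_eq_abs, Real.norm_natCast,
    Real.norm_of_nonneg (hG.le.trans h), ← div_eq_mul_inv, div_div]
  gcongr

lemma hasDerivAt_besselEntire {ν : ℝ} (hν : 0 ≤ ν) (z : ℝ) :
    HasDerivAt (besselEntire ν) (besselEntire (ν + 1) z) z := by
  set c : ℕ → ℝ := fun n => ((n.factorial : ℝ) * Real.Gamma ((n : ℝ) + ν + 1))⁻¹ with hc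
  have hshift (w : ℝ) (n : ℕ) : ((n + 1 : ℕ) : ℝ) * w ^ (n + 1 - 1) * c (n + 1)
      = w ^ n / ((n.factorial : ℝ) * Real.Gamma ((n : ℝ) + (ν + 1) + 1)) := by
    have e : ((n + 1 : ℕ) : ℝ) + ν + 1 = (n : ℝ) + (ν + 1) + 1 := by push_cast; ring
    have hG : Real.Gamma ((n : ℝ) + (ν + 1) + 1) ≠ 0 := (Real.Gamma_pos_of_pos (by positivity)).ne'
    simp only [hc, e, Nat.factorial_succ, Nat.add_sub_cancel]
    push_cast
    field_simp
  have hsum (w : ℝ) : Summable fun n : ℕ => (n : ℝ) * w ^ (n - 1) * c n := by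
    rw [← summable_nat_add_iff 1]
    simpa only [hshift] using summable_besselEntire (by positivity : 0 ≤ ν + 1) w
  have hcpos (n : ℕ) : 0 ≤ c n :=
    inv_nonneg.2 (mul_nonneg (by positivity) (Real.Gamma_pos_of_pos (by positivity)).le)
  have key := hasDerivAt_tsum_of_isPreconnected (g := fun n w => w ^ n * c n)
    (g' := fun n w => (n : ℝ) * w ^ (n - 1) * c n) (hsum (|z| + 1)) Metric.isOpen_ball
    (convex_ball (0 : ℝ) (|z| + 1)).isPreconnected
    (fun n y _ => (hasDerivAt_pow n y).mul_const _)
    (fun n y hy => by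
      have hy' : |y| < |z| + 1 := by simpa using hy
      rw [norm_mul, norm_mul, norm_pow, Real.norm_natCast, Real.norm_eq_abs,
        Real.norm_of_nonneg (hcpos n)]
      have := hcpos n
      gcongr)
    (y₀ := z) (by simp) (by simpa only [hc, div_eq_mul_inv] using summable_besselEntire hν z)
    (y := z) (by simp)
  rw [(hsum z).tsum_eq_zero_add] at key
  simp only [hshift] at key
  refine (key.congr_of_eventuallyEq (.of_forall fun w => ?_)).congr_deriv ?_
  · simp only [besselEntire, hc, div_eq_mul_inv]
  · simp [besselEntire]

lemma besselEntire_eq_add {ν : ℝ} (hν : 0 ≤ ν) (z : ℝ) :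
    besselEntire ν z = (ν + 1) * besselEntire (ν + 1) z + z * besselEntire (ν + 2) z := by
  have h1 := summable_besselEntire (by positivity : 0 ≤ ν + 1) z
  have h0 := summable_besselEntire hν z
  have h2 := (summable_besselEntire (by positivity : 0 ≤ ν + 2) z).mul_left z
  unfold besselEntire
  have hterm (n : ℕ) : z ^ n / ((n.factorial : ℝ) * Real.Gamma ((n : ℝ) + ν + 1))
      - (ν + 1) * (z ^ n / ((n.factorial : ℝ) * Real.Gamma ((n : ℝ) + (ν + 1) + 1)))
      = n * (z ^ n / ((n.factorial : ℝ) * Real.Gamma ((n : ℝ) + (ν + 1) + 1))) := by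
    have hG : Real.Gamma ((n : ℝ) + ν + 1) ≠ 0 := (Real.Gamma_pos_of_pos (by positivity)).ne'
    have hn : (n : ℝ) + ν + 1 ≠ 0 := by positivity
    rw [← add_assoc (n : ℝ) ν 1, Real.Gamma_add_one hn]
    field_simp
    ring
  rw [← sub_eq_iff_eq_add', ← tsum_mul_left, ← tsum_mul_left, ← h0.tsum_sub (h1.mul_left _)]
  have hs := h0.sub (h1.mul_left (ν + 1))
  simp only [hterm] at hs ⊢
  rw [hs.tsum_eq_zero_add]
  simp only [Nat.cast_zero, zero_mul, zero_add]
  refine tsum_congr fun n => ?_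
  have e : ((n + 1 : ℕ) : ℝ) + (ν + 1) + 1 = (n : ℝ) + (ν + 2) + 1 := by push_cast; ring
  rw [e, Nat.factorial_succ]
  push_cast
  field_simp
  ring

lemma besselEntire_zero (ν : ℝ) : besselEntire ν 0 = (Real.Gamma (ν + 1))⁻¹ := by
  rw [besselEntire, tsum_eq_single 0 (fun n hn => by simp [hn])]
  simp

lemma besselEntire_nonneg {ν z : ℝ} (hν : 0 ≤ ν) (hz : 0 ≤ z) : 0 ≤ besselEntire ν z :=
  tsum_nonneg fun n => div_nonneg (by positivity)
    (mul_nonneg (by positivity) (Real.Gamma_pos_of_pos (by positivity)).le)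

lemma besselI_eq_rpow_mul_besselEntire (ν : ℝ) {x : ℝ} (hx : 0 < x) :
    besselI ν x = (x / 2) ^ ν * besselEntire ν (x ^ 2 / 4) := by
  rw [besselI, besselEntire, ← tsum_mul_left]
  refine tsum_congr fun n => ?_
  rw [Real.rpow_add (by positivity), mul_comm (2 : ℝ), Real.rpow_mul (by positivity),
    Real.rpow_natCast, Real.rpow_ofNat, ← pow_mul, mul_comm n 2, pow_mul,
    show (x / 2) ^ 2 = x ^ 2 / 4 by ring]
  ring

lemma besselI_nonneg {ν x : ℝ} (hν : 0 ≤ ν) (hx : 0 < x) : 0 ≤ besselI ν x := by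
  rw [besselI_eq_rpow_mul_besselEntire ν hx]
  exact mul_nonneg (by positivity) (besselEntire_nonneg hν (by positivity))

lemma besselI_sub_besselI_add_two {ν x : ℝ} (hν : 0 ≤ ν) (hx : 0 < x) :
    besselI ν x - besselI (ν + 2) x = 2 * (ν + 1) / x * besselI (ν + 1) x := by
  have hx2 : (0 : ℝ) < x / 2 := by positivity
  rw [besselI_eq_rpow_mul_besselEntire _ hx, besselI_eq_rpow_mul_besselEntire _ hx,
    besselI_eq_rpow_mul_besselEntire _ hx, besselEntire_eq_add hν, Real.rpow_add hx2,
    Real.rpow_add hx2, Real.rpow_one, Real.rpow_ofNat]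
  field_simp
  ring

lemma hasDerivAt_besselI {ν x : ℝ} (hν : 0 ≤ ν) (hx : 0 < x) :
    HasDerivAt (besselI ν) (besselI (ν + 1) x + ν / x * besselI ν x) x := by
  have hx2 : (0 : ℝ) < x / 2 := by positivity
  have h1 : HasDerivAt (fun y : ℝ => (y / 2) ^ ν) (1 / 2 * ν * (x / 2) ^ (ν - 1)) x :=
    ((hasDerivAt_id x).div_const 2).rpow_const (Or.inl hx2.ne')
  have h2 : HasDerivAt (fun y : ℝ => y ^ 2 / 4) (x / 2) x :=
    ((hasDerivAt_pow 2 x).div_const 4).congr_deriv (by push_cast; ring)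
  have h3 := h1.mul ((hasDerivAt_besselEntire hν (x ^ 2 / 4)).comp x h2)
  refine (h3.congr_of_eventuallyEq ?_).congr_deriv ?_
  · filter_upwards [Ioi_mem_nhds hx] with y hy
    exact besselI_eq_rpow_mul_besselEntire ν hy
  · rw [besselI_eq_rpow_mul_besselEntire _ hx, besselI_eq_rpow_mul_besselEntire _ hx,
      Real.rpow_add hx2, Real.rpow_one, Real.rpow_sub_one hx2.ne']
    simp only [Function.comp_apply]
    field_simp
    ring

lemma integrableOn_rpow_mul_exp_neg_mul {a r : ℝ} (ha : 0 < a) (hr : 0 < r) :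
    IntegrableOn (fun t : ℝ => t ^ (a - 1) * Real.exp (-(r * t))) (Ioi 0) := by
  simpa using integrableOn_rpow_mul_exp_neg_mul_rpow (p := 1) (s := a - 1) (by linarith)
    one_pos hr

lemma exp_image_Ioi_zero : Real.exp '' Ioi 0 = Ioi 1 := by
  ext y
  constructor
  · rintro ⟨t, ht, rfl⟩
    exact Real.one_lt_exp_iff.2 ht
  · intro hy
    exact ⟨Real.log y, Real.log_pos hy, Real.exp_log (one_pos.trans hy)⟩

lemma abs_exp_smul_rpow_mul_exp (a r t : ℝ) :
    |Real.exp t| • (Real.exp t ^ (a - 1) * Real.exp (-(r * Real.exp t)))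
      = Real.exp (-(r * Real.exp t)) * Real.exp (a * t) := by
  rw [abs_of_pos (Real.exp_pos t), smul_eq_mul, ← Real.exp_mul, ← Real.exp_add, ← Real.exp_add,
    ← Real.exp_add]
  ring_nf

lemma integrableOn_exp_neg_mul_exp {a r : ℝ} (ha : 0 < a) (hr : 0 < r) :
    IntegrableOn (fun t : ℝ => Real.exp (-(r * Real.exp t)) * Real.exp (a * t)) (Ioi 0) := by
  have h := integrableOn_image_iff_integrableOn_abs_deriv_smul measurableSet_Ioi
    (fun t (_ : t ∈ Ioi (0 : ℝ)) => (Real.hasDerivAt_exp t).hasDerivWithinAt)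
    Real.exp_injective.injOn (fun t : ℝ => t ^ (a - 1) * Real.exp (-(r * t)))
  simp only [abs_exp_smul_rpow_mul_exp] at h
  rw [← h, exp_image_Ioi_zero]
  exact (integrableOn_rpow_mul_exp_neg_mul ha hr).mono_set (Ioi_subset_Ioi zero_le_one)

lemma integral_exp_neg_mul_exp_le {a r : ℝ} (ha : 0 < a) (hr : 0 < r) :
    ∫ t in Ioi (0 : ℝ), Real.exp (-(r * Real.exp t)) * Real.exp (a * t)
      ≤ (1 / r) ^ a * Real.Gamma a := by
  have h := integral_image_eq_integral_abs_deriv_smul measurableSet_Ioi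
    (fun t (_ : t ∈ Ioi (0 : ℝ)) => (Real.hasDerivAt_exp t).hasDerivWithinAt)
    Real.exp_injective.injOn (fun t : ℝ => t ^ (a - 1) * Real.exp (-(r * t)))
  simp only [abs_exp_smul_rpow_mul_exp] at h
  rw [← h, exp_image_Ioi_zero, ← Real.integral_rpow_mul_exp_neg_mul_Ioi ha hr]
  refine setIntegral_mono_set (integrableOn_rpow_mul_exp_neg_mul ha hr) ?_
    (Ioi_subset_Ioi zero_le_one).eventuallyLE
  filter_upwards [ae_restrict_mem measurableSet_Ioi] with t (ht : 0 < t)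
  exact mul_nonneg (Real.rpow_nonneg ht.le _) (Real.exp_pos _).le

lemma exp_neg_mul_cosh_le {x : ℝ} (hx : 0 ≤ x) (t : ℝ) :
    Real.exp (-x * Real.cosh t) ≤ Real.exp (-(x / 2 * Real.exp t)) := by
  rw [Real.exp_le_exp, Real.cosh_eq]
  nlinarith [mul_nonneg hx (Real.exp_pos (-t)).le]

lemma cosh_mul_le_exp {ν t : ℝ} (ht : 0 < t) : Real.cosh (ν * t) ≤ Real.exp ((|ν| + 1) * t) := by
  have h : |ν * t| ≤ (|ν| + 1) * t := by
    rw [abs_mul, abs_of_pos ht]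
    linarith
  rw [← Real.cosh_abs]
  have h1 : Real.exp (-|ν * t|) ≤ Real.exp |ν * t| :=
    Real.exp_le_exp.2 (by linarith [abs_nonneg (ν * t)])
  rw [Real.cosh_eq]
  linarith [Real.exp_le_exp.2 h]

lemma integrableOn_besselK (ν : ℝ) {x : ℝ} (hx : 0 < x) :
    IntegrableOn (fun t => Real.exp (-x * Real.cosh t) * Real.cosh (ν * t)) (Ioi 0) := by
  refine Integrable.mono' (integrableOn_exp_neg_mul_exp (a := |ν| + 1) (r := x / 2)
    (by positivity) (by positivity)) (by fun_prop) ?_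
  filter_upwards [ae_restrict_mem measurableSet_Ioi] with t (ht : 0 < t)
  rw [Real.norm_of_nonneg (mul_nonneg (Real.exp_pos _).le (Real.cosh_pos _).le)]
  exact mul_le_mul (exp_neg_mul_cosh_le hx.le t) (cosh_mul_le_exp ht) (Real.cosh_pos _).le
    (Real.exp_pos _).le

lemma besselK_nonneg (ν x : ℝ) : 0 ≤ besselK ν x :=
  integral_nonneg fun _ => mul_nonneg (Real.exp_pos _).le (Real.cosh_pos _).le

lemma besselK_le_besselK {μ ν x : ℝ} (h : |μ| ≤ |ν|) (hx : 0 < x) :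
    besselK μ x ≤ besselK ν x := by
  refine integral_mono (integrableOn_besselK μ hx) (integrableOn_besselK ν hx) fun t => ?_
  refine mul_le_mul_of_nonneg_left (Real.cosh_le_cosh.2 ?_) (Real.exp_pos _).le
  rw [abs_mul, abs_mul]
  gcongr

lemma besselK_le {ν x : ℝ} (hν : 0 < ν) (hx : 0 < x) :
    besselK ν x ≤ ((2 / x) ^ ν * Real.Gamma ν + 1 / ν) / 2 := by
  have hx2 : 0 < x / 2 := by positivity
  have h1 := integrableOn_exp_neg_mul_exp hν hx2
  have h2 : IntegrableOn (fun t => Real.exp (-ν * t)) (Ioi 0) :=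
    integrableOn_exp_mul_Ioi (neg_lt_zero.2 hν) 0
  calc besselK ν x
      ≤ ∫ t in Ioi (0 : ℝ), (Real.exp (-(x / 2 * Real.exp t)) * Real.exp (ν * t)
          + Real.exp (-ν * t)) / 2 := by
        refine integral_mono (integrableOn_besselK ν hx) ((h1.add h2).div_const 2) fun t => ?_
        have h3 := exp_neg_mul_cosh_le hx.le t
        have h4 : Real.exp (-x * Real.cosh t) ≤ 1 :=
          Real.exp_le_one_iff.2 (by nlinarith [Real.cosh_pos t])
        have h5 := mul_le_mul_of_nonneg_right h3 (Real.exp_pos (ν * t)).le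
        have h6 := mul_le_mul_of_nonneg_right h4 (Real.exp_pos (-ν * t)).le
        simp only [Real.cosh_eq (ν * t), ← neg_mul] at h5 ⊢
        linarith
    _ = ((∫ t in Ioi (0 : ℝ), Real.exp (-(x / 2 * Real.exp t)) * Real.exp (ν * t))
          + 1 / ν) / 2 := by
        rw [integral_div, integral_add h1 h2, integral_exp_mul_Ioi (neg_lt_zero.2 hν)]
        simp
    _ ≤ _ := by
        have := integral_exp_neg_mul_exp_le hν hx2
        rw [one_div_div] at this
        gcongr

lemma cosh_mul_cosh_mul (ν t : ℝ) :
    Real.cosh t * Real.cosh (ν * t)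
      = (Real.cosh ((ν + 1) * t) + Real.cosh ((ν - 1) * t)) / 2 := by
  rw [add_mul, sub_mul, one_mul, Real.cosh_add, Real.cosh_sub]
  ring

lemma sinh_mul_sinh_mul (ν t : ℝ) :
    Real.sinh t * Real.sinh (ν * t)
      = (Real.cosh ((ν + 1) * t) - Real.cosh ((ν - 1) * t)) / 2 := by
  rw [add_mul, sub_mul, one_mul, Real.cosh_add, Real.cosh_sub]
  ring

lemma exp_mul_cosh_mul_cosh_mul (ν x t : ℝ) :
    Real.exp (-x * Real.cosh t) * -Real.cosh t * Real.cosh (ν * t)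
      = -((Real.exp (-x * Real.cosh t) * Real.cosh ((ν + 1) * t)
        + Real.exp (-x * Real.cosh t) * Real.cosh ((ν - 1) * t)) / 2) := by
  linear_combination -Real.exp (-x * Real.cosh t) * cosh_mul_cosh_mul ν t

lemma integrableOn_deriv_besselK (ν : ℝ) {x : ℝ} (hx : 0 < x) :
    IntegrableOn (fun t => Real.exp (-x * Real.cosh t) * -Real.cosh t * Real.cosh (ν * t))
      (Ioi 0) := by
  simp only [exp_mul_cosh_mul_cosh_mul]
  exact (((integrableOn_besselK (ν + 1) hx).add (integrableOn_besselK (ν - 1) hx)).div_const 2).neg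

lemma hasDerivAt_besselK_neg_half (ν : ℝ) {x : ℝ} (hx : 0 < x) :
    HasDerivAt (besselK ν) (-((besselK (ν + 1) x + besselK (ν - 1) x) / 2)) x := by
  have key := (hasDerivAt_integral_of_dominated_loc_of_deriv_le
    (μ := volume.restrict (Ioi (0 : ℝ))) (x₀ := x) (s := Ioi (x / 2))
    (F := fun y t => Real.exp (-y * Real.cosh t) * Real.cosh (ν * t))
    (F' := fun y t => Real.exp (-y * Real.cosh t) * -Real.cosh t * Real.cosh (ν * t))
    (bound := fun t => ‖Real.exp (-(x / 2) * Real.cosh t) * -Real.cosh t * Real.cosh (ν * t)‖)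
    (Ioi_mem_nhds (by linarith)) (.of_forall fun y => by fun_prop) (integrableOn_besselK ν hx)
    (by fun_prop) (.of_forall fun t y hy => ?_)
    (integrableOn_deriv_besselK ν (half_pos hx)).norm (.of_forall fun t y _ => ?_)).2
  · refine key.congr_deriv ?_
    simp only [exp_mul_cosh_mul_cosh_mul]
    rw [integral_neg, integral_div,
      integral_add (integrableOn_besselK (ν + 1) hx) (integrableOn_besselK (ν - 1) hx)]
    rfl
  · have hy' : x / 2 < y := hy
    simp only [norm_mul, Real.norm_of_nonneg (Real.exp_pos _).le]
    gcongr
  · have h : HasDerivAt (fun y : ℝ => -y * Real.cosh t) (-Real.cosh t) y := by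
      simpa using (hasDerivAt_neg y).mul_const (Real.cosh t)
    exact h.exp.mul_const _

lemma besselK_add_one_sub_besselK_sub_one (ν : ℝ) {x : ℝ} (hx : 0 < x) :
    besselK (ν + 1) x - besselK (ν - 1) x = 2 * ν / x * besselK ν x := by
  have hd (t : ℝ) : HasDerivAt (fun t => Real.exp (-x * Real.cosh t) * Real.sinh (ν * t))
      (ν * (Real.exp (-x * Real.cosh t) * Real.cosh (ν * t))
        - x / 2 * (Real.exp (-x * Real.cosh t) * Real.cosh ((ν + 1) * t)
          - Real.exp (-x * Real.cosh t) * Real.cosh ((ν - 1) * t))) t := by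
    have h1 := ((Real.hasDerivAt_cosh t).const_mul (-x)).exp
    have h2 := ((hasDerivAt_id t).const_mul ν).sinh
    refine (h1.mul h2).congr_deriv ?_
    simp only [id_eq]
    linear_combination -x * Real.exp (-x * Real.cosh t) * sinh_mul_sinh_mul ν t
  have hK := (integrableOn_besselK ν hx).const_mul ν
  have hK1 := integrableOn_besselK (ν + 1) hx
  have hK2 := integrableOn_besselK (ν - 1) hx
  have hK3 : IntegrableOn (fun t => x / 2 * (Real.exp (-x * Real.cosh t) * Real.cosh ((ν + 1) * t)
      - Real.exp (-x * Real.cosh t) * Real.cosh ((ν - 1) * t))) (Ioi 0) :=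
    (hK1.sub hK2).const_mul (x / 2)
  have hint := hK.sub hK3
  have hF : IntegrableOn (fun t => Real.exp (-x * Real.cosh t) * Real.sinh (ν * t)) (Ioi 0) := by
    refine (integrableOn_besselK ν hx).mono' (by fun_prop) (.of_forall fun t => ?_)
    rw [norm_mul, Real.norm_of_nonneg (Real.exp_pos _).le, Real.norm_eq_abs]
    gcongr
    rw [abs_le, Real.sinh_eq, Real.cosh_eq]
    constructor <;> linarith [Real.exp_pos (ν * t), Real.exp_pos (-(ν * t))]
  have h := integral_Ioi_of_hasDerivAt_of_tendsto' (fun t _ => hd t) hint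
    (tendsto_zero_of_hasDerivAt_of_integrableOn_Ioi (a := 0) (fun t _ => hd t) hint hF)
  rw [integral_sub hK hK3, integral_const_mul, integral_const_mul, integral_sub hK1 hK2] at h
  simp only [mul_zero, Real.sinh_zero, sub_zero] at h
  change ν * besselK ν x - x / 2 * (besselK (ν + 1) x - besselK (ν - 1) x) = 0 at h
  field_simp
  linarith

lemma hasDerivAt_besselK (ν : ℝ) {x : ℝ} (hx : 0 < x) :
    HasDerivAt (besselK ν) (-besselK (ν + 1) x + ν / x * besselK ν x) x := by
  refine (hasDerivAt_besselK_neg_half ν hx).congr_deriv ?_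
  linear_combination (1 / 2 : ℝ) * besselK_add_one_sub_besselK_sub_one ν hx

lemma hasDerivAt_mul_besselI_mul_besselK {ν x : ℝ} (hν : 0 ≤ ν) (hx : 0 < x) :
    HasDerivAt (fun y => y * (besselI (ν + 1) y * besselK ν y + besselI ν y * besselK (ν + 1) y))
      0 x := by
  have hI := hasDerivAt_besselI hν hx
  have hI1 := hasDerivAt_besselI (by positivity : 0 ≤ ν + 1) hx
  have hK := hasDerivAt_besselK ν hx
  have hK1 := hasDerivAt_besselK (ν + 1) hx
  refine ((hasDerivAt_id x).mul ((hI1.mul hK).add (hI.mul hK1))).congr_deriv ?_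
  have eI := besselI_sub_besselI_add_two hν hx
  have eK := besselK_add_one_sub_besselK_sub_one (ν + 1) hx
  rw [add_sub_cancel_right] at eK
  rw [show ν + 1 + 1 = ν + 2 by ring] at *
  rw [eq_sub_of_add_eq' (sub_add_cancel (besselI ν x) (besselI (ν + 2) x)), eI,
    eq_add_of_sub_eq eK]
  simp only [id_eq, Pi.add_apply, Pi.mul_apply]
  field_simp
  ring

lemma mul_besselI_mul_besselK_le {ν x : ℝ} (hν : 0 ≤ ν) (hx : 0 < x) :
    x * (besselI (ν + 1) x * besselK ν x + besselI ν x * besselK (ν + 1) x)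
      ≤ (Real.Gamma (ν + 1) + (x / 2) ^ ν * x / (2 * (ν + 1)))
        * (besselEntire ν (x ^ 2 / 4) + x / 2 * besselEntire (ν + 1) (x ^ 2 / 4)) := by
  have hx2 : 0 < x / 2 := by positivity
  have hν1 : 0 < ν + 1 := by positivity
  have hK : besselK ν x ≤ besselK (ν + 1) x :=
    besselK_le_besselK (by rw [abs_of_nonneg hν, abs_of_pos hν1]; linarith) hx
  have hE : 0 ≤ besselEntire ν (x ^ 2 / 4) + x / 2 * besselEntire (ν + 1) (x ^ 2 / 4) :=
    add_nonneg (besselEntire_nonneg hν (by positivity))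
      (mul_nonneg hx2.le (besselEntire_nonneg hν1.le (by positivity)))
  calc x * (besselI (ν + 1) x * besselK ν x + besselI ν x * besselK (ν + 1) x)
      ≤ x * (besselI (ν + 1) x * besselK (ν + 1) x + besselI ν x * besselK (ν + 1) x) := by
        gcongr
        exact besselI_nonneg hν1.le hx
    _ = x * (x / 2) ^ ν * besselK (ν + 1) x
        * (besselEntire ν (x ^ 2 / 4) + x / 2 * besselEntire (ν + 1) (x ^ 2 / 4)) := by
        rw [besselI_eq_rpow_mul_besselEntire _ hx, besselI_eq_rpow_mul_besselEntire _ hx,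
          Real.rpow_add hx2, Real.rpow_one]
        ring
    _ ≤ x * (x / 2) ^ ν * (((2 / x) ^ (ν + 1) * Real.Gamma (ν + 1) + 1 / (ν + 1)) / 2)
        * (besselEntire ν (x ^ 2 / 4) + x / 2 * besselEntire (ν + 1) (x ^ 2 / 4)) := by
        gcongr
        exact besselK_le hν1 hx
    _ = _ := by
        have hpos : 0 < (x / 2) ^ ν := Real.rpow_pos_of_pos hx2 ν
        rw [← inv_div x 2, Real.inv_rpow hx2.le, Real.rpow_add hx2, Real.rpow_one]
        congr 1
        field_simp

lemma mul_besselI_mul_besselK_le_one {ν x : ℝ} (hν : 0 ≤ ν) (hx : 0 < x) :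
    x * (besselI (ν + 1) x * besselK ν x + besselI ν x * besselK (ν + 1) x) ≤ 1 := by
  set g : ℝ → ℝ := fun y =>
    y * (besselI (ν + 1) y * besselK ν y + besselI ν y * besselK (ν + 1) y) with hg
  have hd (y : ℝ) (hy : y ∈ Ioi (0 : ℝ)) : HasDerivAt g 0 y :=
    hasDerivAt_mul_besselI_mul_besselK hν hy
  have hconst (y : ℝ) (hy : y ∈ Ioi (0 : ℝ)) : g x = g y :=
    isOpen_Ioi.is_const_of_deriv_eq_zero isPreconnected_Ioi
      (fun y hy => (hd y hy).differentiableAt.differentiableWithinAt)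
      (fun y hy => (hd y hy).deriv) hx hy
  have hc (μ : ℝ) (hμ : 0 ≤ μ) : Continuous (besselEntire μ) :=
    continuous_iff_continuousAt.2 fun z => (hasDerivAt_besselEntire hμ z).continuousAt
  have hc0 := hc ν hν
  have hc1 := hc (ν + 1) (by positivity)
  have hp : Continuous fun y : ℝ => (y / 2) ^ ν :=
    (continuous_id.div_const 2).rpow_const fun _ => Or.inr hν
  have hlim : Tendsto (fun y : ℝ => (Real.Gamma (ν + 1) + (y / 2) ^ ν * y / (2 * (ν + 1)))
      * (besselEntire ν (y ^ 2 / 4) + y / 2 * besselEntire (ν + 1) (y ^ 2 / 4)))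
      (nhdsWithin 0 (Ioi 0)) (nhds 1) := by
    refine (Continuous.tendsto' (by fun_prop) 0 1 ?_).mono_left nhdsWithin_le_nhds
    have hG : Real.Gamma (ν + 1) ≠ 0 := (Real.Gamma_pos_of_pos (by positivity)).ne'
    simp [besselEntire_zero, hG]
  refine ge_of_tendsto hlim ?_
  filter_upwards [self_mem_nhdsWithin] with y hy
  exact (hconst y hy).trans_le (mul_besselI_mul_besselK_le hν hy)

theorem stmt7 (ν : ℝ) (hν : 0 ≤ ν) :
    MonotoneOn (fun x : ℝ => besselI ν x * besselK ν x + Real.log x) (Ioi 0) := by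
  have hd (x : ℝ) (hx : 0 < x) :=
    ((hasDerivAt_besselI hν hx).mul (hasDerivAt_besselK ν hx)).add (Real.hasDerivAt_log hx.ne')
  refine monotoneOn_of_deriv_nonneg (convex_Ioi 0)
    (fun x hx => (hd x hx).continuousAt.continuousWithinAt)
    (fun x hx => (hd x (interior_subset hx)).differentiableAt.differentiableWithinAt)
    fun x hx => ?_
  have hx0 : 0 < x := interior_subset hx
  refine (hd x hx0).deriv.symm ▸ ?_
  have hW := mul_besselI_mul_besselK_le_one hν hx0
  rw [← le_div_iff₀' hx0, one_div] at hW
  have h1 : 0 ≤ ν / x * (besselI ν x * besselK ν x) :=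
    mul_nonneg (by positivity) (mul_nonneg (besselI_nonneg hν hx0) (besselK_nonneg ν x))
  have h2 : 0 ≤ besselI (ν + 1) x * besselK ν x :=
    mul_nonneg (besselI_nonneg (by positivity) hx0) (besselK_nonneg ν x)
  linarith
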